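/- Let μ ∈ N be nonzero. Then tr((Ric_μ)²)/‖μ‖⁴ ≤ tr((Ric_λ)²)/‖λ‖⁴ for every λ in the GL(n,ℝ)-orbit of μ if and only if there exist c ∈ ℝ and D ∈ Der(μ) such that Ric_μ = c·I + D. (A left-invariant metric on a nilpotent Lie group minimizes the norm of the Ricci tensor among all left-invariant metrics with the same scalar curvature — equivalently it is a Ricci soliton, equivalently it extends to a rank-one Einstein solvmanifold — if and only if Ric = cI + D with D a derivation.) -/

import Mathlib

open scoped BigOperators
open Matrix

noncomputable section

/-- vectors in `ℝ^m`. -/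
abbrev Vec (m : ℕ) := Fin m → ℝ

/-- bilinear-map candidates `ℝ^m × ℝ^m → ℝ^m`. -/
abbrev Bil (m : ℕ) := Vec m → Vec m → Vec m

/-- the `i`-th standard basis vector of `ℝ^m`. -/
def bvec (m : ℕ) (i : Fin m) : Vec m := Pi.single i 1

/-- `μ` is a skew-symmetric bilinear map, i.e. an element of `V = Λ²(ℝ^m)* ⊗ ℝ^m`. -/
def IsSkewBil {m : ℕ} (μ : Bil m) : Prop :=
  (∀ Y, IsLinearMap ℝ fun X => μ X Y) ∧ (∀ X, IsLinearMap ℝ (μ X)) ∧ ∀ X Y, μ X Y = -μ Y X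

/-- the Jacobi identity for `μ`. -/
def IsJacobi {m : ℕ} (μ : Bil m) : Prop :=
  ∀ X Y Z, μ (μ X Y) Z + μ (μ Y Z) X + μ (μ Z X) Y = 0

/-- iterated left multiplications `μ(X (k-1), ⋯ μ(X 0, Y))`. -/
def adPow {m : ℕ} (μ : Bil m) (X : ℕ → Vec m) : ℕ → Vec m → Vec m
  | 0, Y => Y
  | k + 1, Y => μ (X k) (adPow μ X k Y)

/-- nilpotency of the bracket `μ`. -/
def IsNilpotentBil {m : ℕ} (μ : Bil m) : Prop :=
  ∃ k : ℕ, ∀ (X : ℕ → Vec m) (Y : Vec m), adPow μ X k Y = 0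

/-- membership in the variety `N` of nilpotent Lie brackets on `ℝ^m`. -/
def NilBracket {m : ℕ} (μ : Bil m) : Prop :=
  IsSkewBil μ ∧ IsJacobi μ ∧ IsNilpotentBil μ

/-- the `GL_m(ℝ)` action `(g.μ)(X,Y) = g μ(g⁻¹X, g⁻¹Y)` on `V`. -/
def mact {m : ℕ} (g : Matrix (Fin m) (Fin m) ℝ) (μ : Bil m) : Bil m :=
  fun X Y => g.mulVec (μ (g⁻¹.mulVec X) (g⁻¹.mulVec Y))

/-- `‖μ‖²` for the natural inner product on `V`. -/
def normSqV {m : ℕ} (μ : Bil m) : ℝ :=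
  ∑ i, ∑ j, ∑ k, (μ (bvec m i) (bvec m j) k) ^ 2

/-- the Ricci operator of `(N_μ, ⟨·,·⟩)`, as a matrix:
`⟨Ric_μ X, Y⟩ = -(1/2) Σ ⟨μ(X,Xᵢ),Xⱼ⟩⟨μ(Y,Xᵢ),Xⱼ⟩ + (1/4) Σ ⟨μ(Xᵢ,Xⱼ),X⟩⟨μ(Xᵢ,Xⱼ),Y⟩`. -/
def RicM {m : ℕ} (μ : Bil m) : Matrix (Fin m) (Fin m) ℝ :=
  Matrix.of fun x y =>
    -(1/2) * (∑ i, ∑ j, μ (bvec m x) (bvec m i) j * μ (bvec m y) (bvec m i) j)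
    + (1/4) * (∑ i, ∑ j, μ (bvec m i) (bvec m j) x * μ (bvec m i) (bvec m j) y)

/-- `D` is a derivation of the bracket `μ`. -/
def IsDerivation {m : ℕ} (μ : Bil m) (D : Matrix (Fin m) (Fin m) ℝ) : Prop :=
  ∀ X Y, D.mulVec (μ X Y) = μ (D.mulVec X) Y + μ X (D.mulVec Y)

/-- the matrix of `ad_μ X : Y ↦ μ(X,Y)`. -/
def adMat {m : ℕ} (μ : Bil m) (X : Vec m) : Matrix (Fin m) (Fin m) ℝ :=
  Matrix.of fun j i => μ X (bvec m i) j

/-- the moment-map value `M_μ = -4 Σᵢ (ad_μ Xᵢ)ᵗ(ad_μ Xᵢ) + 2 Σᵢ (ad_μ Xᵢ)(ad_μ Xᵢ)ᵗ`. -/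
def Mmat {m : ℕ} (μ : Bil m) : Matrix (Fin m) (Fin m) ℝ :=
  (-4 : ℝ) • (∑ i, (adMat μ (bvec m i))ᵀ * adMat μ (bvec m i))
    + (2 : ℝ) • (∑ i, adMat μ (bvec m i) * (adMat μ (bvec m i))ᵀ)

/-- the 2-form `ω(X,Y) = ⟨X, JY⟩`. -/
def sympForm {m : ℕ} (J : Matrix (Fin m) (Fin m) ℝ) (X Y : Vec m) : ℝ :=
  X ⬝ᵥ J.mulVec Y

/-- closedness of a 2-form `ω` with respect to the bracket `μ`:
`ω(μ(X,Y),Z) + ω(μ(Y,Z),X) + ω(μ(Z,X),Y) = 0`. -/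
def IsClosedForm {m : ℕ} (ω : Vec m → Vec m → ℝ) (μ : Bil m) : Prop :=
  ∀ X Y Z, ω (μ X Y) Z + ω (μ Y Z) X + ω (μ Z X) Y = 0

/-- membership in `Sp(n,ℝ)`: invertible and preserving `ω = ⟨·, J·⟩`. -/
def IsSymplMat {m : ℕ} (J g : Matrix (Fin m) (Fin m) ℝ) : Prop :=
  IsUnit g ∧ ∀ X Y, sympForm J (g.mulVec X) (g.mulVec Y) = sympForm J X Y

/-- membership in `GL(n,ℂ) = {g : gJ = Jg}`. -/
def IsCxMat {m : ℕ} (J g : Matrix (Fin m) (Fin m) ℝ) : Prop :=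
  IsUnit g ∧ g * J = J * g

/-- the anti-complexified Ricci operator `Ric^{ac} = (1/2)(Ric + J Ric J)`. -/
def Ricac {m : ℕ} (J : Matrix (Fin m) (Fin m) ℝ) (μ : Bil m) : Matrix (Fin m) (Fin m) ℝ :=
  (1/2 : ℝ) • (RicM μ + J * RicM μ * J)

/-- the complexified Ricci operator `Ric^{c} = (1/2)(Ric − J Ric J)`. -/
def Ricc {m : ℕ} (J : Matrix (Fin m) (Fin m) ℝ) (μ : Bil m) : Matrix (Fin m) (Fin m) ℝ :=
  (1/2 : ℝ) • (RicM μ - J * RicM μ * J)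


def piA {n : ℕ} (A : Matrix (Fin n) (Fin n) ℝ) (μ : Bil n) : Bil n :=
  fun X Y => A *ᵥ μ X Y - μ (A *ᵥ X) Y - μ X (A *ᵥ Y)

def ipV {n : ℕ} (φ ψ : Bil n) : ℝ :=
  ∑ i, ∑ j, φ (bvec n i) (bvec n j) ⬝ᵥ ψ (bvec n i) (bvec n j)

/-- bilinear -/
def IsBil {n : ℕ} (μ : Bil n) : Prop :=
  (∀ Y, IsLinearMap ℝ fun X => μ X Y) ∧ (∀ X, IsLinearMap ℝ (μ X))

theorem IsSkewBil.bil {n : ℕ} {μ : Bil n} (h : IsSkewBil μ) : IsBil μ := ⟨h.1, h.2.1⟩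

theorem vec_expand {n : ℕ} (X : Vec n) : X = ∑ i, X i • bvec n i := by
  ext k
  simp [bvec, Finset.sum_apply, Pi.single_apply]

theorem mulVec_bvec {n : ℕ} (A : Matrix (Fin n) (Fin n) ℝ) (i : Fin n) :
    A *ᵥ bvec n i = fun x => A x i := by
  ext k; simp [bvec]

theorem lin_expand {n : ℕ} {f : Vec n → Vec n} (hf : IsLinearMap ℝ f) (X : Vec n) :
    f X = ∑ i, X i • f (bvec n i) := by
  have := congrArg (hf.mk' f) (vec_expand X)
  simpa using this

theorem IsBil.left {n : ℕ} {μ : Bil n} (h : IsBil μ) (X Y : Vec n) :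
    μ X Y = ∑ i, X i • μ (bvec n i) Y := lin_expand (h.1 Y) X

theorem IsBil.right {n : ℕ} {μ : Bil n} (h : IsBil μ) (X Y : Vec n) :
    μ X Y = ∑ j, Y j • μ X (bvec n j) := lin_expand (h.2 X) Y

theorem IsBil.ext {n : ℕ} {μ ν : Bil n} (h : IsBil μ) (h' : IsBil ν)
    (H : ∀ i j k, μ (bvec n i) (bvec n j) k = ν (bvec n i) (bvec n j) k) : μ = ν := by
  funext X Y
  rw [h.left, h'.left]
  refine Finset.sum_congr rfl fun i _ => ?_
  rw [h.right, h'.right]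
  congr 1
  refine Finset.sum_congr rfl fun j _ => ?_
  congr 1
  funext k
  exact H i j k

theorem mact_bil {n : ℕ} {μ : Bil n} (h : IsBil μ) (g : Matrix (Fin n) (Fin n) ℝ) :
    IsBil (mact g μ) := by
  refine ⟨fun Y => ⟨fun a b => ?_, fun c a => ?_⟩, fun X => ⟨fun a b => ?_, fun c a => ?_⟩⟩
  · simp only [mact, mulVec_add, (h.1 _).map_add]
  · simp only [mact, mulVec_smul, (h.1 _).map_smul]
  · simp only [mact, mulVec_add, (h.2 _).map_add]
  · simp only [mact, mulVec_smul, (h.2 _).map_smul]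

theorem mact_skew {n : ℕ} {μ : Bil n} (h : IsSkewBil μ) (g : Matrix (Fin n) (Fin n) ℝ) :
    IsSkewBil (mact g μ) := by
  refine ⟨(mact_bil h.bil g).1, (mact_bil h.bil g).2, fun X Y => ?_⟩
  simp only [mact]
  rw [h.2.2, mulVec_neg]

theorem piA_bil {n : ℕ} {μ : Bil n} (h : IsBil μ) (A : Matrix (Fin n) (Fin n) ℝ) :
    IsBil (piA A μ) := by
  refine ⟨fun Y => ⟨fun a b => ?_, fun c a => ?_⟩, fun X => ⟨fun a b => ?_, fun c a => ?_⟩⟩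
  · simp only [piA, mulVec_add, (h.1 _).map_add]; abel
  · simp only [piA, mulVec_smul, (h.1 _).map_smul, smul_sub]
  · simp only [piA, mulVec_add, (h.2 _).map_add]; abel
  · simp only [piA, mulVec_smul, (h.2 _).map_smul, smul_sub]

theorem smul_bil {n : ℕ} {μ : Bil n} (h : IsBil μ) (r : ℝ) :
    IsBil (r • μ) := by
  refine ⟨fun Y => ⟨fun a b => ?_, fun c a => ?_⟩, fun X => ⟨fun a b => ?_, fun c a => ?_⟩⟩
  · simp only [Pi.smul_apply, (h.1 _).map_add, smul_add]
  · simp only [Pi.smul_apply, (h.1 _).map_smul, smul_comm r c]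
  · simp only [Pi.smul_apply, (h.2 _).map_add, smul_add]
  · simp only [Pi.smul_apply, (h.2 _).map_smul, smul_comm r c]

theorem mact_mact {n : ℕ} (μ : Bil n) (g h : Matrix (Fin n) (Fin n) ℝ) :
    mact g (mact h μ) = mact (g * h) μ := by
  funext X Y
  simp only [mact, mulVec_mulVec, Matrix.mul_inv_rev]

theorem mact_one {n : ℕ} (μ : Bil n) : mact 1 μ = μ := by
  funext X Y
  simp [mact]

theorem mact_smul {n : ℕ} (μ : Bil n) (g : Matrix (Fin n) (Fin n) ℝ) (r : ℝ) :
    mact g (r • μ) = r • mact g μ := by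
  funext X Y
  simp [mact, mulVec_smul]

theorem piA_mact {n : ℕ} (μ : Bil n) (A g : Matrix (Fin n) (Fin n) ℝ)
    (hg : IsUnit g) : piA A (mact g μ) = mact g (piA (g⁻¹ * A * g) μ) := by
  have hd : IsUnit g.det := (Matrix.isUnit_iff_isUnit_det g).1 hg
  funext X Y
  simp only [mact, piA, mulVec_mulVec, mulVec_sub, Matrix.mul_assoc,
    Matrix.mul_nonsing_inv_cancel_left _ _ hd, Matrix.mul_nonsing_inv _ hd, Matrix.mul_one]

theorem normSqV_eq {n : ℕ} (μ : Bil n) : normSqV μ = ipV μ μ := by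
  simp [normSqV, ipV, dotProduct, sq]

theorem lin_orth {n : ℕ} {Q : Matrix (Fin n) (Fin n) ℝ} (hQ : Q * Qᵀ = 1)
    {f g : Vec n → Vec n} (hf : IsLinearMap ℝ f) (hg : IsLinearMap ℝ g) :
    ∑ i, f (Q *ᵥ bvec n i) ⬝ᵥ g (Q *ᵥ bvec n i) = ∑ i, f (bvec n i) ⬝ᵥ g (bvec n i) := by
  let F : Matrix (Fin n) (Fin n) ℝ := Matrix.of fun k i => f (bvec n i) k
  let G : Matrix (Fin n) (Fin n) ℝ := Matrix.of fun k i => g (bvec n i) k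
  have key : ∀ (f : Vec n → Vec n) (hf : IsLinearMap ℝ f) (i k : Fin n),
      f (Q *ᵥ bvec n i) k = ((Matrix.of fun k i => f (bvec n i) k) * Q : Matrix _ _ ℝ) k i := by
    intro f hf i k
    rw [lin_expand hf, mulVec_bvec]
    simp [Matrix.mul_apply, Finset.sum_apply, mul_comm]
  have h1 : ∑ i, f (Q *ᵥ bvec n i) ⬝ᵥ g (Q *ᵥ bvec n i) = trace ((F * Q)ᵀ * (G * Q)) := by
    simp only [trace, diag, Matrix.mul_apply (M := (F * Q)ᵀ), dotProduct, transpose_apply,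
      key f hf, key g hg, F, G]
  have h2 : ∑ i, f (bvec n i) ⬝ᵥ g (bvec n i) = trace (Fᵀ * G) := by
    simp [trace, Matrix.mul_apply, dotProduct, F, G]
  rw [h1, h2, transpose_mul, Matrix.mul_assoc, trace_mul_comm, Matrix.mul_assoc, Matrix.mul_assoc,
    hQ, Matrix.mul_one]

theorem ipV_mact {n : ℕ} {Q : Matrix (Fin n) (Fin n) ℝ} (hQ : Q * Qᵀ = 1)
    {φ ψ : Bil n} (hφ : IsBil φ) (hψ : IsBil ψ) :
    ipV (mact Q φ) (mact Q ψ) = ipV φ ψ := by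
  have hQ' : Qᵀ * Q = 1 := mul_eq_one_comm.1 hQ
  have hi : Q⁻¹ = Qᵀ := Matrix.inv_eq_right_inv hQ
  have hdot : ∀ X Y : Vec n, (Q *ᵥ X) ⬝ᵥ (Q *ᵥ Y) = X ⬝ᵥ Y := by
    intro X Y
    rw [dotProduct_mulVec, ← mulVec_transpose, mulVec_mulVec, hQ', one_mulVec]
  have hQt : Qᵀ * Qᵀᵀ = 1 := by simpa using hQ'
  simp only [ipV, mact, hdot, hi]
  rw [Finset.sum_congr rfl fun i _ => lin_orth hQt (hφ.2 _) (hψ.2 _), Finset.sum_comm,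
    Finset.sum_congr rfl fun j _ => lin_orth hQt (hφ.1 _) (hψ.1 _), Finset.sum_comm]

theorem trace_ric {n : ℕ} {μ : Bil n} (h : IsSkewBil μ) (A : Matrix (Fin n) (Fin n) ℝ) :
    trace (RicM μ * A) = 1 / 4 * ipV (piA A μ) μ := by
  set c : Fin n → Fin n → Fin n → ℝ := fun i j k => μ (bvec n i) (bvec n j) k with hc
  have e1 : ∀ i j k, μ (A *ᵥ bvec n i) (bvec n j) k = ∑ x, A x i * c x j k := by
    intro i j k
    rw [h.bil.left, mulVec_bvec]; simp [hc]
  have e2 : ∀ i j k, μ (bvec n i) (A *ᵥ bvec n j) k = ∑ x, A x j * c i x k := by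
    intro i j k
    rw [h.bil.right, mulVec_bvec]; simp [hc]
  have sk : ∀ i j k, c i j k = - c j i k := by
    intro i j k
    simp only [hc]; rw [h.2.2]; rfl
  have t1 : ipV (piA A μ) μ = ∑ i, ∑ j, ∑ k, ∑ x, A k x * c i j x * c i j k
      - ∑ i, ∑ j, ∑ k, ∑ x, A x i * c x j k * c i j k
      - ∑ i, ∑ j, ∑ k, ∑ x, A x j * c i x k * c i j k := by
    simp only [ipV, piA, dotProduct, Pi.sub_apply, e1, e2, ← Finset.sum_sub_distrib, sub_mul,
      Finset.sum_mul, mulVec]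
    rfl
  have t2 : ∑ i, ∑ j, ∑ k, ∑ x, A x j * c i x k * c i j k
      = ∑ i, ∑ j, ∑ k, ∑ x, A x i * c x j k * c i j k := by
    rw [Finset.sum_comm]
    refine Finset.sum_congr rfl fun i _ => Finset.sum_congr rfl fun j _ =>
      Finset.sum_congr rfl fun k _ => Finset.sum_congr rfl fun x _ => ?_
    rw [sk j x, sk j i]; ring
  have t3 : trace (RicM μ * A) = -(1/2) * ∑ x, ∑ y, ∑ i, ∑ j, A y x * c y i j * c x i j
      + 1/4 * ∑ x, ∑ y, ∑ i, ∑ j, A y x * c i j y * c i j x := by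
    simp only [trace, diag, Matrix.mul_apply, RicM, Matrix.of_apply, Finset.mul_sum,
      ← Finset.sum_add_distrib, add_mul, Finset.sum_mul]
    refine Finset.sum_congr rfl fun i _ => Finset.sum_congr rfl fun j _ =>
      Finset.sum_congr rfl fun k _ => Finset.sum_congr rfl fun x _ => ?_
    simp only [hc]; ring
  have t4 : ∑ i, ∑ j, ∑ k, ∑ x, A x i * c x j k * c i j k
      = ∑ x, ∑ y, ∑ i, ∑ j, A y x * c y i j * c x i j := by
    refine Finset.sum_congr rfl fun i _ => ?_
    rw [Finset.sum_comm]
    conv_rhs => rw [Finset.sum_comm]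
    rw [Finset.sum_comm]
    exact Finset.sum_congr rfl fun j _ => Finset.sum_comm
  have t5 : ∑ i, ∑ j, ∑ k, ∑ x, A k x * c i j x * c i j k
      = ∑ x, ∑ y, ∑ i, ∑ j, A y x * c i j y * c i j x := by
    have : ∀ f : Fin n → Fin n → Fin n → Fin n → ℝ, ∑ i, ∑ j, ∑ k, ∑ x, f i j k x
        = ∑ k, ∑ x, ∑ i, ∑ j, f i j k x := by
      intro f
      rw [Finset.sum_congr rfl fun i _ => Finset.sum_comm, Finset.sum_comm]
      refine Finset.sum_congr rfl fun k _ => ?_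
      rw [Finset.sum_congr rfl fun i _ => Finset.sum_comm, Finset.sum_comm]
    rw [this, Finset.sum_comm]
    rw [Finset.sum_comm]
    rw [Finset.sum_comm]
    refine Finset.sum_congr rfl fun k _ => Finset.sum_congr rfl fun x _ =>
      Finset.sum_congr rfl fun i _ => Finset.sum_congr rfl fun j _ => ?_
    ring
  rw [t1, t2, t3, t4, t5]; ring

theorem ric_mact {n : ℕ} {Q : Matrix (Fin n) (Fin n) ℝ} (hQ : Q * Qᵀ = 1)
    {μ : Bil n} (h : IsSkewBil μ) : RicM (mact Q μ) = Q * RicM μ * Qᵀ := by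
  have hi : Q⁻¹ = Qᵀ := Matrix.inv_eq_right_inv hQ
  have hu : IsUnit Q := IsUnit.of_mul_eq_one _ hQ
  refine Matrix.ext_iff_trace_mul_right.2 fun A => ?_
  rw [trace_ric (mact_skew h Q), piA_mact _ _ _ hu, ipV_mact hQ (piA_bil h.bil _) h.bil,
    ← trace_ric h, hi, Matrix.mul_assoc Q, Matrix.mul_assoc Q, trace_mul_comm Q]
  simp only [Matrix.mul_assoc]

theorem trace_ric_mact {n : ℕ} {Q : Matrix (Fin n) (Fin n) ℝ} (hQ : Q * Qᵀ = 1)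
    {μ : Bil n} (h : IsSkewBil μ) :
    trace (RicM (mact Q μ) * RicM (mact Q μ)) = trace (RicM μ * RicM μ) := by
  have hQ' : Qᵀ * Q = 1 := mul_eq_one_comm.1 hQ
  rw [ric_mact hQ h, Matrix.mul_assoc, Matrix.mul_assoc, trace_mul_comm]
  simp only [Matrix.mul_assoc, hQ', Matrix.mul_one]
  rw [← Matrix.mul_assoc Qᵀ, hQ', Matrix.one_mul]

theorem normSqV_mact {n : ℕ} {Q : Matrix (Fin n) (Fin n) ℝ} (hQ : Q * Qᵀ = 1)
    {μ : Bil n} (h : IsSkewBil μ) : normSqV (mact Q μ) = normSqV μ := by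
  rw [normSqV_eq, normSqV_eq, ipV_mact hQ h.bil h.bil]

theorem normSqV_pos {n : ℕ} {μ : Bil n} (h : IsBil μ) (h0 : μ ≠ 0) : 0 < normSqV μ := by
  have hnn : 0 ≤ normSqV μ := by unfold normSqV; positivity
  refine lt_of_le_of_ne hnn fun he => h0 ?_
  refine h.ext ⟨fun Y => ⟨by simp, by simp⟩, fun X => ⟨by simp, by simp⟩⟩ fun i j k => ?_
  have h1 := (Finset.sum_eq_zero_iff_of_nonneg (fun i _ => by positivity)).1 he.symm i
    (Finset.mem_univ _)
  have h2 := (Finset.sum_eq_zero_iff_of_nonneg (fun i _ => by positivity)).1 h1 j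
    (Finset.mem_univ _)
  have h3 := (Finset.sum_eq_zero_iff_of_nonneg (fun i _ => by positivity)).1 h2 k
    (Finset.mem_univ _)
  simpa using h3

theorem mact_inv_cancel {n : ℕ} (μ : Bil n) {g : Matrix (Fin n) (Fin n) ℝ} (hg : IsUnit g) :
    mact g⁻¹ (mact g μ) = μ := by
  rw [mact_mact, Matrix.nonsing_inv_mul _ ((Matrix.isUnit_iff_isUnit_det g).1 hg), mact_one]

theorem mact_ne_zero {n : ℕ} {μ : Bil n} (h0 : μ ≠ 0) {g : Matrix (Fin n) (Fin n) ℝ}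
    (hg : IsUnit g) : mact g μ ≠ 0 := by
  intro h
  apply h0
  rw [← mact_inv_cancel μ hg, h]
  funext X Y
  simp [mact]

theorem ric_symm {n : ℕ} (μ : Bil n) : (RicM μ)ᵀ = RicM μ := by
  ext x y
  simp only [transpose_apply, RicM, Matrix.of_apply, mul_comm]

theorem spectral {n : ℕ} (R : Matrix (Fin n) (Fin n) ℝ) (hR : Rᵀ = R) :
    ∃ (U : Matrix (Fin n) (Fin n) ℝ) (b : Fin n → ℝ), U * Uᵀ = 1 ∧ Antitone b ∧
      U * R * Uᵀ = diagonal b := by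
  have hH : R.IsHermitian := by
    rw [Matrix.IsHermitian, Matrix.conjTranspose_eq_transpose_of_trivial, hR]
  let S := Matrix.toEuclideanLin R
  have hS : S.IsSymmetric := Matrix.isSymmetric_toEuclideanLin_iff.2 hH
  have hn : Module.finrank ℝ (EuclideanSpace ℝ (Fin n)) = n := by simp
  let v := hS.eigenvectorBasis hn
  let b := hS.eigenvalues hn
  have horth : ∀ i j, ∑ k, (v i) k * (v j) k = if i = j then 1 else 0 := by
    intro i j
    have := orthonormal_iff_ite.1 v.orthonormal i j
    rw [← this, PiLp.inner_apply]
    simp [mul_comm]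
  have hU : (Matrix.of fun i k => (v i) k) * (Matrix.of fun i k => (v i) k)ᵀ
      = (1 : Matrix (Fin n) (Fin n) ℝ) := by
    ext i j
    simp [Matrix.mul_apply, horth, Matrix.one_apply]
  refine ⟨Matrix.of fun i k => (v i) k, b, hU, hS.eigenvalues_antitone hn, ?_⟩
  have hRU : R * (Matrix.of fun i k => (v i) k)ᵀ
      = (Matrix.of fun i k => (v i) k)ᵀ * diagonal b := by
    ext k i
    have h1 := hS.apply_eigenvectorBasis hn i
    have h2 := congrArg (fun x : EuclideanSpace ℝ (Fin n) => x k) h1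
    simp only [S, Matrix.toLpLin_apply] at h2
    rw [mul_diagonal]
    simp [mulVec, dotProduct] at h2
    simp [Matrix.mul_apply, v, b]
    rw [h2, mul_comm]
  rw [Matrix.mul_assoc, hRU, ← Matrix.mul_assoc, hU, Matrix.one_mul]

theorem qr {n : ℕ} (M : Matrix (Fin n) (Fin n) ℝ) :
    ∃ Q : Matrix (Fin n) (Fin n) ℝ, Q * Qᵀ = 1 ∧ (Q * M).BlockTriangular id := by
  have hn : Module.finrank ℝ (EuclideanSpace ℝ (Fin n)) = Fintype.card (Fin n) := by simp
  let f : Fin n → EuclideanSpace ℝ (Fin n) := fun i => WithLp.toLp 2 fun k => M k i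
  let v := InnerProductSpace.gramSchmidtOrthonormalBasis hn f
  refine ⟨Matrix.of fun i k => (v i) k, ?_, ?_⟩
  · ext i j
    have := orthonormal_iff_ite.1 v.orthonormal i j
    rw [Matrix.one_apply, ← this, PiLp.inner_apply]
    simp [mul_comm, Matrix.mul_apply]
  · intro i j hij
    have := InnerProductSpace.gramSchmidtOrthonormalBasis_inv_triangular hn f hij
    rw [PiLp.inner_apply] at this
    simpa [Matrix.mul_apply, v, f, mul_comm] using this

theorem diag_bvec {n : ℕ} (b : Fin n → ℝ) (i : Fin n) :
    diagonal b *ᵥ bvec n i = b i • bvec n i := by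
  ext k
  simp only [mulVec_diagonal, bvec, Pi.smul_apply, Pi.single_apply, smul_eq_mul]
  split_ifs with h
  · rw [h]
  · simp

theorem piA_diag {n : ℕ} {ν : Bil n} (h : IsBil ν) (b : Fin n → ℝ) (i j k : Fin n) :
    piA (diagonal b) ν (bvec n i) (bvec n j) k
      = (b k - b i - b j) * ν (bvec n i) (bvec n j) k := by
  simp only [piA, diag_bvec, (h.1 _).map_smul, (h.2 _).map_smul, Pi.sub_apply, mulVec_diagonal,
    Pi.smul_apply, smul_eq_mul]
  ring

theorem ipV_diag {n : ℕ} {ν : Bil n} (h : IsBil ν) (b : Fin n → ℝ) :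
    ipV (piA (diagonal b) ν) ν
      = ∑ i, ∑ j, ∑ k, (b k - b i - b j) * ν (bvec n i) (bvec n j) k ^ 2 := by
  simp only [ipV, dotProduct, piA_diag h]
  refine Finset.sum_congr rfl fun i _ => Finset.sum_congr rfl fun j _ =>
      Finset.sum_congr rfl fun k _ => ?_
  ring

theorem trace_cs {n : ℕ} (R : Matrix (Fin n) (Fin n) ℝ) (hR : Rᵀ = R) (b : Fin n → ℝ) :
    trace (R * diagonal b) ^ 2 ≤ trace (R * R) * trace (diagonal b * diagonal b) := by
  have h1 : trace (R * diagonal b) = ∑ x, R x x * b x := by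
    simp [trace, mul_diagonal]
  have h2 : trace (diagonal b * diagonal b) = ∑ x, b x ^ 2 := by
    simp [trace, sq]
  have h3 : ∑ x, R x x ^ 2 ≤ trace (R * R) := by
    simp only [trace, diag, Matrix.mul_apply]
    refine Finset.sum_le_sum fun x _ => ?_
    have : ∀ y, R x y * R y x = R x y ^ 2 := by
      intro y
      have := congrFun (congrFun hR x) y
      simp only [transpose_apply] at this
      rw [this, sq]
    simp only [this]
    exact Finset.single_le_sum (f := fun y => R x y ^ 2) (fun y _ => sq_nonneg _)
      (Finset.mem_univ x)
  rw [h1, h2]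
  refine (Finset.sum_mul_sq_le_sq_mul_sq _ _ _).trans ?_
  exact mul_le_mul_of_nonneg_right h3 (by positivity)

theorem mact_coord {n : ℕ} {ν : Bil n} (h : IsBil ν) (g : Matrix (Fin n) (Fin n) ℝ)
    (i j k : Fin n) :
    mact g ν (bvec n i) (bvec n j) k
      = ∑ p, ∑ q, ∑ s, g k p * (g⁻¹ q i * (g⁻¹ s j * ν (bvec n q) (bvec n s) p)) := by
  simp only [mact, mulVec_bvec, mulVec, dotProduct]
  refine Finset.sum_congr rfl fun p _ => ?_
  rw [h.left, Finset.sum_apply, Finset.mul_sum]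
  refine Finset.sum_congr rfl fun q _ => ?_
  rw [Pi.smul_apply, h.right, Finset.sum_apply, smul_eq_mul, Finset.mul_sum, Finset.mul_sum]
  rfl

theorem core2_tri {n : ℕ} {ν : Bil n} (h : IsSkewBil ν) (h0 : ν ≠ 0) {b : Fin n → ℝ}
    (hb : Antitone b) (hR : RicM ν = diagonal b) {r : ℝ} (hr : piA (diagonal b) ν = r • ν)
    {T : Matrix (Fin n) (Fin n) ℝ} (hT : IsUnit T) (hTt : T.BlockTriangular id) :
    trace (RicM ν * RicM ν) / (normSqV ν) ^ 2
      ≤ trace (RicM (mact T ν) * RicM (mact T ν)) / (normSqV (mact T ν)) ^ 2 := by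
  have hTi : T⁻¹.BlockTriangular id := by
    have := hT.invertible
    exact blockTriangular_inv_of_blockTriangular hTt
  have hc : ∀ i j k, ν (bvec n i) (bvec n j) k ≠ 0 → b k = b i + b j + r := by
    intro i j k hne
    have h1 := piA_diag h.bil b i j k
    rw [hr] at h1
    simp only [Pi.smul_apply, smul_eq_mul] at h1
    have := mul_right_cancel₀ hne h1
    linarith
  have hl : ∀ i j k, mact T ν (bvec n i) (bvec n j) k ≠ 0 → b i + b j + r ≤ b k := by
    intro i j k hne
    rw [mact_coord h.bil] at hne
    obtain ⟨p, _, hne⟩ := Finset.exists_ne_zero_of_sum_ne_zero hne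
    obtain ⟨q, _, hne⟩ := Finset.exists_ne_zero_of_sum_ne_zero hne
    obtain ⟨s, _, hne⟩ := Finset.exists_ne_zero_of_sum_ne_zero hne
    have n1 := left_ne_zero_of_mul hne
    have hne := right_ne_zero_of_mul hne
    have n2 := left_ne_zero_of_mul hne
    have hne := right_ne_zero_of_mul hne
    have n3 := left_ne_zero_of_mul hne
    have n4 := hc _ _ _ (right_ne_zero_of_mul hne)
    have m1 : k ≤ p := by
      by_contra hlt
      exact n1 (hTt (not_le.1 hlt))
    have m2 : q ≤ i := by
      by_contra hlt
      exact n2 (hTi (not_le.1 hlt))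
    have m3 : s ≤ j := by
      by_contra hlt
      exact n3 (hTi (not_le.1 hlt))
    have := hb m1
    have := hb m2
    have := hb m3
    linarith
  have hN : 0 < normSqV ν := normSqV_pos h.bil h0
  have hs : IsSkewBil (mact T ν) := mact_skew h T
  have hL : 0 < normSqV (mact T ν) := normSqV_pos hs.bil (mact_ne_zero h0 hT)
  have e1 : trace (RicM ν * RicM ν) = r / 4 * normSqV ν := by
    conv_lhs => rw [hR, ← hR]
    rw [trace_ric h, hR, hr, normSqV_eq]
    simp only [ipV, Pi.smul_apply, smul_dotProduct, smul_eq_mul, ← Finset.mul_sum]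
    ring
  have e0 : 0 ≤ trace (RicM ν * RicM ν) := by
    rw [hR]
    simp only [diagonal_mul_diagonal, trace_diagonal]
    exact Finset.sum_nonneg fun i _ => mul_self_nonneg _
  have hr0 : 0 ≤ r := by
    by_contra hlt
    nlinarith [not_le.1 hlt]
  have e2 : r / 4 * normSqV (mact T ν) ≤ trace (RicM (mact T ν) * diagonal b) := by
    rw [trace_ric hs, ipV_diag hs.bil, normSqV]
    have : r * ∑ i, ∑ j, ∑ k, mact T ν (bvec n i) (bvec n j) k ^ 2
      ≤ ∑ i, ∑ j, ∑ k, (b k - b i - b j) * mact T ν (bvec n i) (bvec n j) k ^ 2 := by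
      simp only [Finset.mul_sum]
      refine Finset.sum_le_sum fun i _ => Finset.sum_le_sum fun j _ =>
        Finset.sum_le_sum fun k _ => ?_
      by_cases hz : mact T ν (bvec n i) (bvec n j) k = 0
      · simp [hz]
      · have := hl i j k hz
        exact mul_le_mul_of_nonneg_right (by linarith) (sq_nonneg _)
    linarith
  have e3 := trace_cs (RicM (mact T ν)) (ric_symm _) b
  rw [← hR, e1] at e3
  rw [hR] at e3
  have e4 : (r / 4 * normSqV (mact T ν)) ^ 2 ≤ trace (RicM (mact T ν) * diagonal b) ^ 2 :=
    pow_le_pow_left₀ (by positivity) e2 2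
  rw [e1, div_le_div_iff₀ (by positivity) (by positivity)]
  have e5 := e4.trans e3
  have e6 : 0 ≤ trace (RicM (mact T ν) * RicM (mact T ν)) := by
    have := ric_symm (mact T ν)
    conv_rhs => rw [← this]
    rw [this]
    simp only [trace, diag, Matrix.mul_apply]
    refine Finset.sum_nonneg fun x _ => Finset.sum_nonneg fun y _ => ?_
    have h2 := congrFun (congrFun this x) y
    rw [transpose_apply] at h2
    rw [h2]
    exact mul_self_nonneg _
  rcases hr0.eq_or_lt with h00 | hpos
  · rw [← h00]
    simp only [zero_div, zero_mul]
    positivity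
  · have : r / 4 * normSqV (mact T ν) ^ 2
        ≤ trace (RicM (mact T ν) * RicM (mact T ν)) * normSqV ν := by
      have h4 : 0 < r / 4 := by positivity
      refine le_of_mul_le_mul_left ?_ h4
      nlinarith
    nlinarith

theorem exp_diag_inv {n : ℕ} (b : Fin n → ℝ) (t : ℝ) :
    (diagonal fun i => Real.exp (t * b i)) * (diagonal fun i => Real.exp (-(t * b i)))
      = (1 : Matrix (Fin n) (Fin n) ℝ) := by
  rw [diagonal_mul_diagonal, ← diagonal_one]
  congr 1
  funext i
  rw [← Real.exp_add]; simp

theorem core1 {n : ℕ} {ν : Bil n} (h : IsSkewBil ν) (h0 : ν ≠ 0) {b : Fin n → ℝ}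
    (hR : RicM ν = diagonal b)
    (hmin : ∀ g : Matrix (Fin n) (Fin n) ℝ, IsUnit g →
        trace (RicM ν * RicM ν) / (normSqV ν) ^ 2
          ≤ trace (RicM (mact g ν) * RicM (mact g ν)) / (normSqV (mact g ν)) ^ 2) :
    ∃ s : ℝ, piA (diagonal b) ν = s • ν := by
  set c : Fin n → Fin n → Fin n → ℝ := fun i j k => ν (bvec n i) (bvec n j) k with hc
  set w : Fin n → Fin n → Fin n → ℝ := fun i j k => (b k - b i - b j) * c i j k with hw
  let L : ℝ → Bil n := fun t => mact (diagonal fun i => Real.exp (t * b i)) ν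
  have hLs : ∀ t, IsSkewBil (L t) := fun t => mact_skew h _
  have hL0 : L 0 = ν := by
    simp only [L, zero_mul, Real.exp_zero, diagonal_one, mact_one]
  have hLc : ∀ t i j k, L t (bvec n i) (bvec n j) k = Real.exp (t * (b k - b i - b j)) * c i j k := by
    intro t i j k
    simp only [L, mact, Matrix.inv_eq_right_inv (exp_diag_inv b t), diag_bvec,
      (h.bil.1 _).map_smul, (h.bil.2 _).map_smul, mulVec_diagonal, Pi.smul_apply, smul_eq_mul, hc]
    have : t * (b k - b i - b j) = t * b k + (-(t * b i) + -(t * b j)) := by ring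
    rw [this, Real.exp_add, Real.exp_add]
    ring
  have hd : ∀ i j k, HasDerivAt (fun t => L t (bvec n i) (bvec n j) k) (w i j k) 0 := by
    intro i j k
    simp only [hLc]
    have h1 : HasDerivAt (fun t : ℝ => t * (b k - b i - b j)) (b k - b i - b j) 0 := by
      simpa using (hasDerivAt_id (0 : ℝ)).mul_const (b k - b i - b j)
    have := (h1.exp).mul_const (c i j k)
    simpa [hw] using this
  have hd2 : ∀ i j k, HasDerivAt (fun t => L t (bvec n i) (bvec n j) k ^ 2)
      (2 * (c i j k * w i j k)) 0 := by
    intro i j k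
    have h1 := (hd i j k).fun_pow 2
    have h2 : ((2 : ℕ) : ℝ) * L 0 (bvec n i) (bvec n j) k ^ (2 - 1) * w i j k
        = 2 * (c i j k * w i j k) := by
      rw [hL0, Nat.cast_ofNat, pow_one, mul_assoc]
    rw [← h2]
    exact h1
  have hN : HasDerivAt (fun t => normSqV (L t)) (2 * ∑ i, ∑ j, ∑ k, c i j k * w i j k) 0 := by
    simp only [normSqV, Finset.mul_sum]
    exact HasDerivAt.fun_sum fun i _ => HasDerivAt.fun_sum fun j _ => HasDerivAt.fun_sum fun k _ => hd2 i j k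
  have hRd : ∀ x y, ∃ d, HasDerivAt (fun t => RicM (L t) x y) d 0 := by
    intro x y
    refine ⟨_, DifferentiableAt.hasDerivAt ?_⟩
    simp only [RicM, Matrix.of_apply]
    have hdd : ∀ i j k, DifferentiableAt ℝ (fun t => L t (bvec n i) (bvec n j) k) 0 :=
      fun i j k => (hd i j k).differentiableAt
    refine DifferentiableAt.add (DifferentiableAt.const_mul ?_ _) (DifferentiableAt.const_mul ?_ _)
    · exact DifferentiableAt.fun_sum fun i _ => DifferentiableAt.fun_sum fun j _ =>
        (hdd _ _ _).mul (hdd _ _ _)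
    · exact DifferentiableAt.fun_sum fun i _ => DifferentiableAt.fun_sum fun j _ =>
        (hdd _ _ _).mul (hdd _ _ _)
  choose R' hR' using hRd
  have hT1 : HasDerivAt (fun t => trace (RicM (L t) * diagonal b)) (∑ x, R' x x * b x) 0 := by
    simp only [trace, diag, mul_diagonal]
    exact HasDerivAt.fun_sum fun x _ => (hR' x x).mul_const _
  have hT2 : HasDerivAt (fun t => trace (RicM (L t) * diagonal b))
      (1 / 4 * ∑ i, ∑ j, ∑ k, (b k - b i - b j) * (2 * (c i j k * w i j k))) 0 := by
    have : (fun t => trace (RicM (L t) * diagonal b)) = fun t => 1 / 4 * ∑ i, ∑ j, ∑ k,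
        (b k - b i - b j) * L t (bvec n i) (bvec n j) k ^ 2 := by
      funext t
      rw [trace_ric (hLs t), ipV_diag (hLs t).bil]
    rw [this]
    exact HasDerivAt.const_mul _ (HasDerivAt.fun_sum fun i _ => HasDerivAt.fun_sum fun j _ =>
      HasDerivAt.fun_sum fun k _ => (hd2 i j k).const_mul _)
  have hT12 := hT1.unique hT2
  have hW : 1 / 4 * ∑ i, ∑ j, ∑ k, (b k - b i - b j) * (2 * (c i j k * w i j k))
      = 1 / 2 * ∑ i, ∑ j, ∑ k, w i j k ^ 2 := by
    simp only [Finset.mul_sum]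
    refine Finset.sum_congr rfl fun i _ => Finset.sum_congr rfl fun j _ =>
      Finset.sum_congr rfl fun k _ => ?_
    simp only [hw]; ring
  have hQ : HasDerivAt (fun t => trace (RicM (L t) * RicM (L t)))
      (∑ i, ∑ j, ∑ k, w i j k ^ 2) 0 := by
    have h1 : HasDerivAt (fun t => trace (RicM (L t) * RicM (L t)))
      (∑ x, ∑ y, (R' x y * RicM (L 0) y x + RicM (L 0) x y * R' y x)) 0 := by
      simp only [trace, diag, Matrix.mul_apply]
      exact HasDerivAt.fun_sum fun x _ => HasDerivAt.fun_sum fun y _ => (hR' x y).mul (hR' y x)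
    convert h1 using 1
    rw [hW] at hT12
    have : ∑ x, ∑ y, (R' x y * RicM (L 0) y x + RicM (L 0) x y * R' y x)
        = 2 * ∑ x, R' x x * b x := by
      rw [hL0, hR, Finset.mul_sum]
      refine Finset.sum_congr rfl fun x _ => ?_
      rw [Finset.sum_eq_single x]
      · simp; ring
      · intro y _ hyx
        simp [diagonal_apply_ne _ hyx, diagonal_apply_ne _ hyx.symm]
      · simp
    rw [this, hT12]; ring
  have hN0 : 0 < normSqV ν := normSqV_pos h.bil h0
  set W := ∑ i, ∑ j, ∑ k, w i j k ^ 2 with hWd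
  set P := ∑ i, ∑ j, ∑ k, c i j k * w i j k with hP
  set N := normSqV ν with hNd
  have hTr : trace (RicM ν * RicM ν) = 1 / 4 * P := by
    conv_lhs => rw [hR, ← hR]
    rw [trace_ric h, hR, ipV_diag h.bil, hP]
    congr 1
    refine Finset.sum_congr rfl fun i _ => Finset.sum_congr rfl fun j _ =>
      Finset.sum_congr rfl fun k _ => ?_
    simp only [hw, hc]; ring
  have hF := hQ.div (hN.pow 2) (by simp only [Pi.pow_apply]; rw [hL0]; positivity)
  have hlm : IsLocalMin ((fun t => trace (RicM (L t) * RicM (L t))) /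
      ((fun t => normSqV (L t)) ^ 2)) 0 := by
    refine Filter.Eventually.of_forall fun t => ?_
    simp only [Pi.div_apply, Pi.pow_apply, hL0]
    exact hmin _ (IsUnit.of_mul_eq_one _ (exp_diag_inv b t))
  have hz := hlm.hasDerivAt_eq_zero hF
  simp only [Pi.pow_apply, hL0, hTr] at hz
  rw [div_eq_zero_iff] at hz
  have hz1 : W * N = P ^ 2 := by
    rcases hz with hz | hz
    · have : N * (W * N - P ^ 2) = 0 := by
        rw [← hz, ← hNd]; push_cast; ring
      rcases mul_eq_zero.1 this with h | h
      · exact absurd h hN0.ne'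
      · linarith
    · exact absurd hz (by rw [← hNd]; positivity)
  refine ⟨P / N, (piA_bil h.bil _).ext (smul_bil h.bil _) fun i j k => ?_⟩
  rw [piA_diag h.bil]
  have hsum : ∑ i, ∑ j, ∑ k, (w i j k - P / N * c i j k) ^ 2 = 0 := by
    have : ∑ i, ∑ j, ∑ k, (w i j k - P / N * c i j k) ^ 2
        = W - 2 * (P / N) * P + (P / N) ^ 2 * N := by
      rw [hWd, hNd, normSqV]
      nth_rewrite 3 [hP]
      simp only [Finset.mul_sum, ← Finset.sum_sub_distrib, ← Finset.sum_add_distrib]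
      refine Finset.sum_congr rfl fun i _ => Finset.sum_congr rfl fun j _ =>
        Finset.sum_congr rfl fun k _ => ?_
      simp only [hc]
      ring
    rw [this]
    field_simp
    linarith
  have h1 := (Finset.sum_eq_zero_iff_of_nonneg (fun i _ => by positivity)).1 hsum i
    (Finset.mem_univ _)
  have h2 := (Finset.sum_eq_zero_iff_of_nonneg (fun i _ => by positivity)).1 h1 j
    (Finset.mem_univ _)
  have h3 := (Finset.sum_eq_zero_iff_of_nonneg (fun i _ => by positivity)).1 h2 k
    (Finset.mem_univ _)
  have h4 : w i j k - P / N * c i j k = 0 := by simpa using h3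
  simp only [Pi.smul_apply, smul_eq_mul]
  simp only [hw, hc] at h4
  linarith

/-- a left-invariant metric on a nilpotent Lie group minimizes the norm of the
Ricci tensor among all left-invariant metrics with the same scalar curvature iff
`Ric = cI + D` with `D` a derivation. -/
theorem minimal_iff_riemannian (n : ℕ) (hn : 1 ≤ n)
    (μ : Bil n) (hμ : NilBracket μ) (hμ0 : μ ≠ 0) :
    (∀ g : Matrix (Fin n) (Fin n) ℝ, IsUnit g →
        Matrix.trace (RicM μ * RicM μ) / (normSqV μ) ^ 2
          ≤ Matrix.trace (RicM (mact g μ) * RicM (mact g μ)) / (normSqV (mact g μ)) ^ 2)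
      ↔ ∃ (c : ℝ) (D : Matrix (Fin n) (Fin n) ℝ),
          IsDerivation μ D ∧ RicM μ = c • (1 : Matrix (Fin n) (Fin n) ℝ) + D := by
  have h : IsSkewBil μ := hμ.1
  obtain ⟨U, b, hU, hb, hUR⟩ := spectral (RicM μ) (ric_symm μ)
  have hU' : Uᵀ * U = 1 := mul_eq_one_comm.1 hU
  have hUi : U⁻¹ = Uᵀ := Matrix.inv_eq_right_inv hU
  have hUu : IsUnit U := IsUnit.of_mul_eq_one _ hU
  have hν : IsSkewBil (mact U μ) := mact_skew h U
  have hν0 : mact U μ ≠ 0 := mact_ne_zero hμ0 hUu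
  have hRν : RicM (mact U μ) = diagonal b := by rw [ric_mact hU h, hUR]
  have hpi : piA (diagonal b) (mact U μ) = mact U (piA (RicM μ) μ) := by
    rw [piA_mact _ _ _ hUu, ← hUR, hUi]
    congr 2
    simp only [Matrix.mul_assoc, hU', Matrix.mul_one]
    rw [← Matrix.mul_assoc, hU', Matrix.one_mul]
  have hback : mact U⁻¹ (mact U μ) = μ := mact_inv_cancel μ hUu
  constructor
  · intro hmin
    obtain ⟨s, hs⟩ := core1 hν hν0 hRν (by
      intro g hg
      rw [trace_ric_mact hU h, normSqV_mact hU h, mact_mact]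
      exact hmin _ (hg.mul hUu))
    have hs' : piA (RicM μ) μ = s • μ := by
      rw [← mact_inv_cancel (piA (RicM μ) μ) hUu, ← hpi, hs, mact_smul, hback]
    refine ⟨-s, RicM μ + s • 1, fun X Y => ?_, by simp⟩
    have h1 := congrFun (congrFun hs' X) Y
    simp only [piA, Pi.smul_apply] at h1
    simp only [add_mulVec, smul_mulVec, one_mulVec, (h.1 _).map_add, (h.1 _).map_smul,
      (h.2.1 _).map_add, (h.2.1 _).map_smul, ← h1]
    abel
  · rintro ⟨c, D, hD, hRD⟩ g hg
    have hr : piA (RicM μ) μ = (-c) • μ := by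
      funext X Y
      rw [hRD]
      simp only [piA, Pi.smul_apply, add_mulVec, smul_mulVec, one_mulVec, (h.1 _).map_add,
        (h.1 _).map_smul, (h.2.1 _).map_add, (h.2.1 _).map_smul, hD X Y, neg_smul]
      abel
    have hr' : piA (diagonal b) (mact U μ) = (-c) • mact U μ := by
      rw [hpi, hr, mact_smul]
    obtain ⟨Q, hQ, hT⟩ := qr (g * Uᵀ)
    have hQu : IsUnit Q := IsUnit.of_mul_eq_one _ hQ
    have hUt : IsUnit Uᵀ := IsUnit.of_mul_eq_one _ hU'
    have key := core2_tri hν hν0 hb hRν hr' (hQu.mul (hg.mul hUt)) hT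
    rw [mact_mact, Matrix.mul_assoc Q, Matrix.mul_assoc g, hU', Matrix.mul_one, ← mact_mact,
      trace_ric_mact hU h, normSqV_mact hU h, trace_ric_mact hQ (mact_skew h g),
      normSqV_mact hQ (mact_skew h g)] at key
    exact key
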